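/- (Theorem 1.) Let Ω be a real N×N matrix, H the diagonal indicator matrix of a sampling set, μ a real number, B = H + μΩ invertible, γ = 2μ − μ², and T = (μ − μ²) B^{-1} Ω. If the operator norm satisfies ‖T‖ < 1, then H + γΩ is invertible and the approximate error covariance B^{-1} − (μ − μ²) B^{-1} Ω B^{-1} satisfies the bound ‖(H + γΩ)^{-1} − (B^{-1} − (μ − μ²) B^{-1} Ω B^{-1})‖ ≤ (‖T‖² / (1 − ‖T‖)) · ‖B^{-1}‖. -/

import Mathlib

open Matrix

attribute [local instance] Matrix.linftyOpNormedRing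

/-- A left inverse of `1 + t` differs from its first-order Neumann truncation `1 - t` by at most
`‖t‖² / (1 - ‖t‖)`. -/
theorem norm_leftInverse_one_add_sub_one_sub_le {R : Type*} [NormedRing R] {m t : R}
    (h : m * (1 + t) = 1) (ht : ‖t‖ < 1) :
    ‖m - (1 - t)‖ ≤ ‖t‖ ^ 2 / (1 - ‖t‖) := by
  have key : m - (1 - t) = t * t - (m - (1 - t)) * t := by
    have hm : m = 1 - m * t := by
      rw [eq_sub_iff_add_eq, ← h, mul_add, mul_one]
    calc m - (1 - t) = (1 - m * t) - (1 - t) := by rw [← hm]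
      _ = t * t - (m - (1 - t)) * t := by noncomm_ring
  have hle : ‖m - (1 - t)‖ ≤ ‖t‖ * ‖t‖ + ‖m - (1 - t)‖ * ‖t‖ :=
    calc ‖m - (1 - t)‖ = ‖t * t - (m - (1 - t)) * t‖ := congrArg norm key
      _ ≤ ‖t * t‖ + ‖(m - (1 - t)) * t‖ := norm_sub_le _ _
      _ ≤ ‖t‖ * ‖t‖ + ‖m - (1 - t)‖ * ‖t‖ := add_le_add (norm_mul_le _ _) (norm_mul_le _ _)
  rw [le_div_iff₀ (sub_pos.mpr ht)]
  linarith

/-- **Theorem 1.** For small `μ` the error covariance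
`B⁻¹ − (μ − μ²) B⁻¹ Ω B⁻¹` approximates `(H + γΩ)⁻¹` with `γ = 2μ − μ²`:
if `‖T‖ < 1` for `T = (μ − μ²) B⁻¹ Ω` then `H + γΩ` is invertible and
`‖(H + γΩ)⁻¹ − (B⁻¹ − (μ − μ²) B⁻¹ Ω B⁻¹)‖ ≤ (‖T‖²/(1 − ‖T‖)) ‖B⁻¹‖`. -/
theorem approx_error_covariance
    {N : ℕ} (Ω : Matrix (Fin N) (Fin N) ℝ) (S : Finset (Fin N))
    (H : Matrix (Fin N) (Fin N) ℝ)
    (hH : H = Matrix.diagonal fun i => if i ∈ S then (1 : ℝ) else 0)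
    (μ γ : ℝ) (hγ : γ = 2 * μ - μ ^ 2)
    (B T : Matrix (Fin N) (Fin N) ℝ)
    (hB : B = H + μ • Ω) (hBinv : IsUnit B.det)
    (hT : T = (μ - μ ^ 2) • (B⁻¹ * Ω)) (hTnorm : ‖T‖ < 1) :
    IsUnit (H + γ • Ω).det ∧
      ‖(H + γ • Ω)⁻¹ - (B⁻¹ - (μ - μ ^ 2) • (B⁻¹ * Ω * B⁻¹))‖ ≤
        ‖T‖ ^ 2 / (1 - ‖T‖) * ‖B⁻¹‖ := by
  have hfactor : H + γ • Ω = B * (1 + T) := by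
    rw [hT, mul_add, mul_one, Matrix.mul_smul, Matrix.mul_nonsing_inv_cancel_left _ _ hBinv, hB,
      hγ, add_assoc, ← add_smul]
    congr 2
    ring
  let _ : NormedAlgebra ℝ (Matrix (Fin N) (Fin N) ℝ) := Matrix.linftyOpNormedAlgebra
  have _ : CompleteSpace (Matrix (Fin N) (Fin N) ℝ) := FiniteDimensional.complete ℝ _
  have hunit : IsUnit (1 + T) := by
    simpa using isUnit_one_sub_of_norm_lt_one (x := -T) (by rwa [norm_neg])
  have hdet : IsUnit (1 + T).det := (Matrix.isUnit_iff_isUnit_det _).mp hunit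
  refine ⟨by rw [hfactor, Matrix.det_mul]; exact hBinv.mul hdet, ?_⟩
  have herr : (H + γ • Ω)⁻¹ - (B⁻¹ - (μ - μ ^ 2) • (B⁻¹ * Ω * B⁻¹)) =
      ((1 + T)⁻¹ - (1 - T)) * B⁻¹ := by
    rw [hfactor, Matrix.mul_inv_rev, ← Matrix.smul_mul, ← hT]
    noncomm_ring
  rw [herr]
  exact (norm_mul_le _ _).trans <| mul_le_mul_of_nonneg_right
    (norm_leftInverse_one_add_sub_one_sub_le (Matrix.nonsing_inv_mul _ hdet) hTnorm)
    (norm_nonneg _)
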